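/- arXiv:2603.19847 — 2 statements merged into one kernel-verified Lean document; each statement's English description precedes it below -/
import Mathlib

section
/- Let n, m ∈ ℕ, let A : ℝⁿ → ℝᵐ be a linear map, p ∈ ℝⁿ, and suppose ψ ∈ ℝᵐ lies in the range of A. For α > 0 let x_α = p + (AᵀA + α·I)⁻¹ Aᵀ(ψ − A p) be the unique minimizer of (1/2)‖A x − ψ‖²₂ + (α/2)‖x − p‖²₂. Then as α → 0⁺, x_α converges to x† = p + A⁺(ψ − A p), where A⁺ is the Moore–Penrose pseudoinverse of A; equivalently, x_α converges to the unique solution of A x = ψ that minimizes ‖x − p‖₂ among all solutions. -/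
open scoped InnerProductSpace

section Tikhonov

variable {E F : Type*} [NormedAddCommGroup E] [InnerProductSpace ℝ E]
  [NormedAddCommGroup F] [InnerProductSpace ℝ F]

/-- In finite dimension, every fibre of `A` meets the range of the adjoint. -/
theorem ContinuousLinearMap.exists_apply_adjoint_eq [FiniteDimensional ℝ E] [CompleteSpace E]
    [CompleteSpace F] (A : E →L[ℝ] F) (y : E) :
    ∃ v : F, A (ContinuousLinearMap.adjoint A v) = A y := by
  obtain ⟨k, hk, u, hu, rfl⟩ := A.ker.exists_add_mem_mem_orthogonal y
  rw [ContinuousLinearMap.orthogonal_ker,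
    (Submodule.closed_of_finiteDimensional _).submodule_topologicalClosure_eq] at hu
  obtain ⟨v, hv⟩ := hu
  have hv' : ContinuousLinearMap.adjoint A v = u := hv
  have hk' : A k = 0 := hk
  exact ⟨v, by rw [hv', map_add, hk', zero_add]⟩

/-- If `x - p` is in the range of the adjoint, it is orthogonal to all differences of solutions. -/
theorem norm_sub_sq_eq_add_of_adjoint_eq [CompleteSpace E] [CompleteSpace F] (A : E →L[ℝ] F)
    {p x z : E} {v : F} (hv : x - p = ContinuousLinearMap.adjoint A v) (hz : A z = A x) :
    ‖z - p‖ ^ 2 = ‖z - x‖ ^ 2 + ‖x - p‖ ^ 2 := by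
  have h : ⟪z - x, x - p⟫_ℝ = 0 := by
    rw [hv, ContinuousLinearMap.adjoint_inner_right, map_sub, hz, sub_self, inner_zero_left]
  rw [← sub_add_sub_cancel z x p, norm_add_sq_real, h]
  ring

/-- Error bound for Tikhonov regularization under the source condition `x - p = Aᵀ v`. -/
theorem norm_tikhonov_sub_sq_le [CompleteSpace E] [CompleteSpace F] (A : E →L[ℝ] F)
    {p x y : E} {v : F} {α : ℝ} (hα : 0 < α) (hv : x - p = ContinuousLinearMap.adjoint A v)
    (hy : ContinuousLinearMap.adjoint A (A y - A x) + α • (y - p) = 0) :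
    ‖y - x‖ ^ 2 ≤ α * ‖v‖ ^ 2 := by
  have h : ‖A (y - x)‖ ^ 2 + α * (‖y - x‖ ^ 2 + ⟪v, A (y - x)⟫_ℝ) = 0 := by
    have := congrArg (fun w => ⟪w, y - x⟫_ℝ) hy
    simpa only [← map_sub, ← sub_add_sub_cancel y x p, hv, inner_add_left, inner_smul_left,
      ContinuousLinearMap.adjoint_inner_left, real_inner_self_eq_norm_sq, inner_zero_left,
      conj_trivial] using this
  have hsq : 0 ≤ ‖A (y - x) + α • v‖ ^ 2 := sq_nonneg _
  rw [norm_add_sq_real, inner_smul_right, real_inner_comm, norm_smul, mul_pow,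
    Real.norm_eq_abs, sq_abs] at hsq
  have hA := sq_nonneg ‖A (y - x)‖
  have hscaled : α * ‖y - x‖ ^ 2 ≤ α * (α * ‖v‖ ^ 2) := by
    nlinarith [mul_nonneg (sq_nonneg α) (sq_nonneg ‖v‖)]
  exact le_of_mul_le_mul_left hscaled hα

end Tikhonov

/-- Let `A : ℝⁿ → ℝᵐ` be linear, `p ∈ ℝⁿ`, and let `ψ` be attainable,
`ψ = A x̄`.  For each `α > 0` let `x α` be the unique minimizer of
`(1/2)‖A x − ψ‖² + (α/2)‖x − p‖²`, characterized by the normal equation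
`Aᵀ(A x_α − ψ) + α(x_α − p) = 0`.  Then, as `α → 0⁺`, `x α` converges to
`x† = p + A⁺(ψ − A p)`, i.e. to the unique solution of `A x = ψ` minimizing `‖x − p‖`
among all solutions. -/
theorem tikhonov_converges_to_minimum_norm_solution
    (n m : ℕ) (A : EuclideanSpace ℝ (Fin n) →L[ℝ] EuclideanSpace ℝ (Fin m))
    (p : EuclideanSpace ℝ (Fin n)) (ψ : EuclideanSpace ℝ (Fin m))
    (hψ : ∃ xbar : EuclideanSpace ℝ (Fin n), A xbar = ψ)
    (x : ℝ → EuclideanSpace ℝ (Fin n))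
    (hx : ∀ α : ℝ, 0 < α →
      ContinuousLinearMap.adjoint A (A (x α) - ψ) + α • (x α - p) = 0) :
    ∃ xdag : EuclideanSpace ℝ (Fin n),
      A xdag = ψ ∧
      (∀ z : EuclideanSpace ℝ (Fin n), A z = ψ → ‖xdag - p‖ ≤ ‖z - p‖) ∧
      (∀ z : EuclideanSpace ℝ (Fin n),
        (A z = ψ ∧ ∀ w, A w = ψ → ‖z - p‖ ≤ ‖w - p‖) → z = xdag) ∧
      Filter.Tendsto x (nhdsWithin 0 (Set.Ioi 0)) (nhds xdag) := by
  obtain ⟨xbar, rfl⟩ := hψ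
  obtain ⟨v, hv⟩ := A.exists_apply_adjoint_eq (xbar - p)
  obtain ⟨xdag, hxdag⟩ : ∃ xdag, xdag = p + ContinuousLinearMap.adjoint A v := ⟨_, rfl⟩
  have hsource : xdag - p = ContinuousLinearMap.adjoint A v := by rw [hxdag, add_sub_cancel_left]
  have hA : A xdag = A xbar := by rw [hxdag, map_add, hv, map_sub, add_sub_cancel]
  have pythagoras (z) (hz : A z = A xbar) : ‖z - p‖ ^ 2 = ‖z - xdag‖ ^ 2 + ‖xdag - p‖ ^ 2 :=
    norm_sub_sq_eq_add_of_adjoint_eq A hsource (hz.trans hA.symm)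
  refine ⟨xdag, hA, fun z hz => ?_, fun z ⟨hz, hmin⟩ => ?_, ?_⟩
  · refine (sq_le_sq₀ (norm_nonneg _) (norm_nonneg _)).mp ?_
    linarith [pythagoras z hz, sq_nonneg ‖z - xdag‖]
  · have hle := pow_le_pow_left₀ (norm_nonneg _) (hmin xdag hA) 2
    have hzero : ‖z - xdag‖ ^ 2 = 0 :=
      le_antisymm (by linarith [pythagoras z hz]) (sq_nonneg _)
    exact sub_eq_zero.mp (norm_eq_zero.mp (pow_eq_zero_iff two_ne_zero |>.mp hzero))
  · rw [tendsto_iff_norm_sub_tendsto_zero]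
    have hbound : Filter.Tendsto (fun α : ℝ => √(α * ‖v‖ ^ 2))
        (nhdsWithin 0 (Set.Ioi 0)) (nhds 0) := by
      have hcont : Continuous fun α : ℝ => √(α * ‖v‖ ^ 2) := by fun_prop
      simpa using (hcont.tendsto 0).mono_left nhdsWithin_le_nhds
    refine squeeze_zero' (Filter.Eventually.of_forall fun _ => norm_nonneg _) ?_ hbound
    filter_upwards [self_mem_nhdsWithin] with α hα
    exact Real.le_sqrt_of_sq_le (norm_tikhonov_sub_sq_le A hα hsource (hA ▸ hx α hα))
end

section
/- Let n, m ∈ ℕ, let A : ℝⁿ → ℝᵐ be a linear map, ψ ∈ ℝᵐ, p ∈ ℝⁿ, α > 0, and set F(x) = (1/2)‖A x − ψ‖²₂, G(x) = α‖x − p‖₁, Φ = F + G, with L = ‖AᵀA‖ a Lipschitz constant of ∇F. Fix a step size λ ∈ (0, 1/L], assume L > 0, and let x* be a minimizer of Φ. Define the FISTA iterates by y₁ = x₀, h₁ = 1, and for k ≥ 1: x_k = prox_{λG}( y_k − λ ∇F(y_k) ), h_{k+1} = (1 + √(1 + 4 h_k²))/2, y_{k+1} = x_k + ((h_k − 1)/h_{k+1})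 (x_k − x_{k−1}). Then for every k ≥ 1, Φ(x_k) − Φ(x*) ≤ 2 ‖x₀ − x*‖²₂ / ( λ (k+1)² ); in particular Φ(x_k) → Φ(x*) as k → ∞. -/
/-- The smooth data-discrepancy `F(x) = (1/2)‖A x − ψ‖²`. -/
noncomputable def Fdata {n m : ℕ}
    (A : EuclideanSpace ℝ (Fin n) →L[ℝ] EuclideanSpace ℝ (Fin m))
    (ψ : EuclideanSpace ℝ (Fin m)) (x : EuclideanSpace ℝ (Fin n)) : ℝ :=
  (1 / 2) * ‖A x - ψ‖ ^ 2

/-- The nonsmooth penalty `G(x) = α‖x − p‖₁`. -/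
noncomputable def Gpen {n : ℕ} (p : EuclideanSpace ℝ (Fin n)) (α : ℝ)
    (x : EuclideanSpace ℝ (Fin n)) : ℝ :=
  α * ∑ i, |x i - p i|

/-- The L¹-causality-regularization objective `Φ = F + G`. -/
noncomputable def PhiL1 {n m : ℕ}
    (A : EuclideanSpace ℝ (Fin n) →L[ℝ] EuclideanSpace ℝ (Fin m))
    (ψ : EuclideanSpace ℝ (Fin m)) (p : EuclideanSpace ℝ (Fin n)) (α : ℝ)
    (x : EuclideanSpace ℝ (Fin n)) : ℝ :=
  Fdata A ψ x + Gpen p α x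

open Filter Topology

open scoped InnerProductSpace

section InnerProduct

variable {E : Type*} [NormedAddCommGroup E] [InnerProductSpace ℝ E]

/-- Variational inequality for a proximal point of a convex function. -/
theorem ConvexOn.sub_le_inner_of_prox {H : E → ℝ} (hH : ConvexOn ℝ Set.univ H) {u w : E}
    (hu : ∀ z, H u + (1 / 2) * ‖u - w‖ ^ 2 ≤ H z + (1 / 2) * ‖z - w‖ ^ 2) (z : E) :
    H u - H z ≤ ⟪u - w, z - u⟫_ℝ := by
  have hseg : ∀ t ∈ Set.Ioo (0 : ℝ) 1,
      H u - H z ≤ ⟪u - w, z - u⟫_ℝ + t * ((1 / 2) * ‖z - u‖ ^ 2) := by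
    rintro t ⟨ht0, ht1⟩
    have hmin := hu ((1 - t) • u + t • z)
    have hconv := hH.2 (Set.mem_univ u) (Set.mem_univ z) (sub_nonneg.2 ht1.le) ht0.le (by ring)
    have hpt : (1 - t) • u + t • z - w = (u - w) + t • (z - u) := by module
    rw [hpt, norm_add_sq_real, inner_smul_right, norm_smul, mul_pow, Real.norm_eq_abs,
      sq_abs] at hmin
    simp only [smul_eq_mul] at hconv
    refine le_of_mul_le_mul_left ?_ ht0
    linarith
  have hlim : Tendsto (fun t : ℝ => ⟪u - w, z - u⟫_ℝ + t * ((1 / 2) * ‖z - u‖ ^ 2)) (𝓝[>] 0)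
      (𝓝 ⟪u - w, z - u⟫_ℝ) := by
    refine Tendsto.mono_left ?_ nhdsWithin_le_nhds
    have hcont : Continuous fun t : ℝ => ⟪u - w, z - u⟫_ℝ + t * ((1 / 2) * ‖z - u‖ ^ 2) := by
      fun_prop
    simpa using hcont.tendsto 0
  refine ge_of_tendsto hlim ?_
  filter_upwards [Ioo_mem_nhdsGT (zero_lt_one' ℝ)] with t ht using hseg t ht

theorem mul_sub_norm_sq_add_norm_sq (c : ℝ) (a s z : E) :
    c * ((c - 1) * ‖a - z‖ ^ 2 + ‖s - z‖ ^ 2)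
      = ‖c • z - (c - 1) • a - s‖ ^ 2 + (c - 1) * ‖a - s‖ ^ 2 := by
  have h₁ : c • z - (c - 1) • a - s = -((c - 1) • (a - z) + (s - z)) := by module
  have h₂ : a - s = (a - z) - (s - z) := by abel
  rw [h₁, h₂, norm_neg]
  generalize a - z = d, s - z = e
  rw [norm_add_sq_real, norm_sub_sq_real, inner_smul_left, norm_smul, mul_pow,
    Real.norm_eq_abs, sq_abs]
  simp only [conj_trivial]
  ring

theorem norm_apply_sq_le_norm_adjoint_comp {E' : Type*} [NormedAddCommGroup E']
    [InnerProductSpace ℝ E'] [CompleteSpace E] [CompleteSpace E'] (A : E →L[ℝ] E') (d : E) :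
    ‖A d‖ ^ 2 ≤ ‖(ContinuousLinearMap.adjoint A).comp A‖ * ‖d‖ ^ 2 := by
  calc ‖A d‖ ^ 2 = ⟪((ContinuousLinearMap.adjoint A).comp A) d, d⟫_ℝ := by
        rw [ContinuousLinearMap.comp_apply, ContinuousLinearMap.adjoint_inner_left,
          real_inner_self_eq_norm_sq]
    _ ≤ ‖((ContinuousLinearMap.adjoint A).comp A) d‖ * ‖d‖ := real_inner_le_norm _ _
    _ ≤ ‖(ContinuousLinearMap.adjoint A).comp A‖ * ‖d‖ * ‖d‖ := by
        gcongr
        exact ContinuousLinearMap.le_opNorm _ _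
    _ = _ := by ring

end InnerProduct

theorem convexOn_Gpen {n : ℕ} (p : EuclideanSpace ℝ (Fin n)) {α : ℝ} (hα : 0 ≤ α) :
    ConvexOn ℝ Set.univ (Gpen p α) := by
  refine ⟨convex_univ, fun u _ v _ a b ha hb hab => ?_⟩
  simp only [Gpen, smul_eq_mul]
  rw [mul_left_comm a, mul_left_comm b, ← mul_add]
  refine mul_le_mul_of_nonneg_left ?_ hα
  rw [Finset.mul_sum, Finset.mul_sum, ← Finset.sum_add_distrib]
  refine Finset.sum_le_sum fun i _ => ?_
  have hi : (a • u + b • v) i - p i = a * (u i - p i) + b * (v i - p i) := by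
    simp only [PiLp.add_apply, PiLp.smul_apply, smul_eq_mul]
    linear_combination p i * hab
  rw [hi]
  refine (abs_add_le _ _).trans_eq ?_
  rw [abs_mul, abs_mul, abs_of_nonneg ha, abs_of_nonneg hb]

theorem Fdata_eq_add_inner {n m : ℕ}
    (A : EuclideanSpace ℝ (Fin n) →L[ℝ] EuclideanSpace ℝ (Fin m))
    (ψ : EuclideanSpace ℝ (Fin m)) (v z : EuclideanSpace ℝ (Fin n)) :
    Fdata A ψ z = Fdata A ψ v + ⟪ContinuousLinearMap.adjoint A (A v - ψ), z - v⟫_ℝ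
      + (1 / 2) * ‖A (z - v)‖ ^ 2 := by
  have hz : A z - ψ = (A v - ψ) + A (z - v) := by
    rw [map_sub]
    abel
  rw [Fdata, Fdata, hz, norm_add_sq_real, ContinuousLinearMap.adjoint_inner_left]
  ring

/-- Fundamental inequality for one proximal-gradient step. -/
theorem PhiL1_sub_le_of_prox {n m : ℕ}
    (A : EuclideanSpace ℝ (Fin n) →L[ℝ] EuclideanSpace ℝ (Fin m))
    (ψ : EuclideanSpace ℝ (Fin m)) (p : EuclideanSpace ℝ (Fin n)) {α lam : ℝ} (hα : 0 ≤ α)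
    (hlam : 0 ≤ lam) (hstep : lam * ‖(ContinuousLinearMap.adjoint A).comp A‖ ≤ 1)
    {u v : EuclideanSpace ℝ (Fin n)}
    (hu : ∀ z : EuclideanSpace ℝ (Fin n),
      lam * Gpen p α u
          + (1 / 2) * ‖u - (v - lam • (ContinuousLinearMap.adjoint A (A v - ψ)))‖ ^ 2
        ≤ lam * Gpen p α z
          + (1 / 2) * ‖z - (v - lam • (ContinuousLinearMap.adjoint A (A v - ψ)))‖ ^ 2)
    (z : EuclideanSpace ℝ (Fin n)) :
    2 * lam * (PhiL1 A ψ p α u - PhiL1 A ψ p α z) ≤ ‖z - v‖ ^ 2 - ‖z - u‖ ^ 2 := by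
  have hvar := ((convexOn_Gpen p hα).smul hlam).sub_le_inner_of_prox hu z
  have hFu := Fdata_eq_add_inner A ψ v u
  have hFz := Fdata_eq_add_inner A ψ v z
  set g := ContinuousLinearMap.adjoint A (A v - ψ)
  have hsplit : u - (v - lam • g) = (u - v) + lam • g := by abel
  have hzu : z - u = (z - v) - (u - v) := by abel
  have hcurv : lam * ‖A (u - v)‖ ^ 2 ≤ ‖u - v‖ ^ 2 :=
    calc lam * ‖A (u - v)‖ ^ 2
        ≤ lam * (‖(ContinuousLinearMap.adjoint A).comp A‖ * ‖u - v‖ ^ 2) :=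
          mul_le_mul_of_nonneg_left (norm_apply_sq_le_norm_adjoint_comp A _) hlam
      _ = lam * ‖(ContinuousLinearMap.adjoint A).comp A‖ * ‖u - v‖ ^ 2 := by ring
      _ ≤ ‖u - v‖ ^ 2 := mul_le_of_le_one_left (sq_nonneg _) hstep
  have hpos : 0 ≤ lam * ‖A (z - v)‖ ^ 2 := by positivity
  rw [PhiL1, PhiL1, hFu, hFz]
  rw [hsplit] at hvar
  rw [hzu] at hvar ⊢
  generalize u - v = d at *
  generalize z - v = e at *
  rw [inner_add_left, inner_smul_left, inner_sub_right, inner_sub_right,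
    real_inner_self_eq_norm_sq] at hvar
  simp only [conj_trivial, smul_eq_mul] at hvar
  rw [norm_sub_sq_real, real_inner_comm d e]
  linarith

/-- The FISTA momentum sequence grows at least linearly. -/
theorem half_succ_le_momentum {h : ℕ → ℝ} (h_one : h 1 = 1)
    (h_succ : ∀ k : ℕ, 1 ≤ k → h (k + 1) = (1 + Real.sqrt (1 + 4 * h k ^ 2)) / 2)
    {k : ℕ} (hk : 1 ≤ k) : ((k : ℝ) + 1) / 2 ≤ h k := by
  induction k, hk using Nat.le_induction with
  | base => norm_num [h_one]
  | succ k hk ih =>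
    have hsqrt : 2 * h k ≤ Real.sqrt (1 + 4 * h k ^ 2) := Real.le_sqrt_of_sq_le (by linarith)
    rw [h_succ k hk]
    push_cast
    linarith

theorem momentum_mul_sub_one {h : ℕ → ℝ}
    (h_succ : ∀ k : ℕ, 1 ≤ k → h (k + 1) = (1 + Real.sqrt (1 + 4 * h k ^ 2)) / 2)
    {k : ℕ} (hk : 1 ≤ k) : h (k + 1) * (h (k + 1) - 1) = h k ^ 2 := by
  have hsq : Real.sqrt (1 + 4 * h k ^ 2) ^ 2 = 1 + 4 * h k ^ 2 := Real.sq_sqrt (by positivity)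
  rw [h_succ k hk]
  linear_combination hsq / 4

/-- Beck–Teboulle (FISTA) objective-value convergence rate for the
L¹-causality regularization algorithm: with step size `λ ∈ (0, 1/L]`, `L = ‖AᵀA‖ > 0`,
iterates `x_k = prox_{λG}(y_k − λ∇F(y_k))` (characterized as the minimizer of
`z ↦ λG(z) + (1/2)‖z − (y_k − λ∇F(y_k))‖²`), `h_{k+1} = (1 + √(1+4h_k²))/2`,
`y_{k+1} = x_k + ((h_k − 1)/h_{k+1})(x_k − x_{k−1})`, one has for every `k ≥ 1`
`Φ(x_k) − Φ(x*) ≤ 2‖x₀ − x*‖² / (λ(k+1)²)`; in particular `Φ(x_k) → Φ(x*)`. -/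
theorem fista_rate
    (n m : ℕ) (A : EuclideanSpace ℝ (Fin n) →L[ℝ] EuclideanSpace ℝ (Fin m))
    (ψ : EuclideanSpace ℝ (Fin m)) (p : EuclideanSpace ℝ (Fin n))
    (α lam L : ℝ) (hα : 0 < α)
    (hL : L = ‖(ContinuousLinearMap.adjoint A).comp A‖) (hL0 : 0 < L)
    (hlam : lam ∈ Set.Ioc (0 : ℝ) (1 / L))
    (x y : ℕ → EuclideanSpace ℝ (Fin n)) (h : ℕ → ℝ)
    (hy1 : y 1 = x 0) (hh1 : h 1 = 1)
    (hprox : ∀ k : ℕ, 1 ≤ k → ∀ z : EuclideanSpace ℝ (Fin n),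
      lam * Gpen p α (x k)
          + (1 / 2) * ‖x k - (y k - lam • (ContinuousLinearMap.adjoint A (A (y k) - ψ)))‖ ^ 2
        ≤ lam * Gpen p α z
          + (1 / 2) * ‖z - (y k - lam • (ContinuousLinearMap.adjoint A (A (y k) - ψ)))‖ ^ 2)
    (hh : ∀ k : ℕ, 1 ≤ k → h (k + 1) = (1 + Real.sqrt (1 + 4 * h k ^ 2)) / 2)
    (hy : ∀ k : ℕ, 1 ≤ k → y (k + 1) = x k + ((h k - 1) / h (k + 1)) • (x k - x (k - 1)))
    (xstar : EuclideanSpace ℝ (Fin n))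
    (hstar : ∀ z : EuclideanSpace ℝ (Fin n), PhiL1 A ψ p α xstar ≤ PhiL1 A ψ p α z) :
    (∀ k : ℕ, 1 ≤ k →
      PhiL1 A ψ p α (x k) - PhiL1 A ψ p α xstar
        ≤ 2 * ‖x 0 - xstar‖ ^ 2 / (lam * ((k : ℝ) + 1) ^ 2)) ∧
    Filter.Tendsto (fun k : ℕ => PhiL1 A ψ p α (x k)) Filter.atTop
      (nhds (PhiL1 A ψ p α xstar)) := by
  obtain ⟨hlam0, hlam1⟩ := hlam
  have hstep : lam * ‖(ContinuousLinearMap.adjoint A).comp A‖ ≤ 1 := by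
    rw [← hL]
    exact (le_div_iff₀ hL0).1 hlam1
  have hprox_ineq := fun k hk =>
    PhiL1_sub_le_of_prox A ψ p hα.le hlam0.le hstep (hprox k hk)
  have hbound : ∀ k : ℕ, 1 ≤ k → ((k : ℝ) + 1) / 2 ≤ h k := fun k hk =>
    half_succ_le_momentum hh1 hh hk
  have henergy : ∀ k : ℕ, 1 ≤ k →
      2 * lam * h k ^ 2 * (PhiL1 A ψ p α (x k) - PhiL1 A ψ p α xstar)
        + ‖h k • x k - (h k - 1) • x (k - 1) - xstar‖ ^ 2 ≤ ‖x 0 - xstar‖ ^ 2 := by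
    intro k hk
    induction k, hk using Nat.le_induction with
    | base =>
      have hfirst := hprox_ineq 1 le_rfl xstar
      rw [hy1, norm_sub_rev xstar, norm_sub_rev xstar] at hfirst
      simp only [hh1, one_smul, sub_self, zero_smul, sub_zero]
      linarith
    | succ k hk ih =>
      have hge : 1 ≤ h (k + 1) := by
        have hk' := hbound (k + 1) (by omega)
        push_cast at hk'
        have : (1 : ℝ) ≤ k := by exact_mod_cast hk
        linarith
      have hprev := mul_le_mul_of_nonneg_left (hprox_ineq (k + 1) (by omega) (x k))
        (mul_nonneg (zero_le_one.trans hge) (sub_nonneg.2 hge))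
      have hopt := mul_le_mul_of_nonneg_left (hprox_ineq (k + 1) (by omega) xstar)
        (zero_le_one.trans hge)
      have hid_y := mul_sub_norm_sq_add_norm_sq (h (k + 1)) (x k) xstar (y (k + 1))
      have hid_x := mul_sub_norm_sq_add_norm_sq (h (k + 1)) (x k) xstar (x (k + 1))
      have hmom : h (k + 1) • y (k + 1) - (h (k + 1) - 1) • x k - xstar
          = h k • x k - (h k - 1) • x (k - 1) - xstar := by
        rw [hy k hk, smul_add, smul_smul, mul_div_cancel₀ _ (by linarith)]
        module
      rw [hmom] at hid_y
      rw [Nat.add_sub_cancel]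
      have hsq := momentum_mul_sub_one hh hk
      rw [← hsq] at ih
      linarith
  have hrate : ∀ k : ℕ, 1 ≤ k →
      PhiL1 A ψ p α (x k) - PhiL1 A ψ p α xstar
        ≤ 2 * ‖x 0 - xstar‖ ^ 2 / (lam * ((k : ℝ) + 1) ^ 2) := by
    intro k hk
    have hgap := sub_nonneg.2 (hstar (x k))
    have hsq : (((k : ℝ) + 1) / 2) ^ 2 ≤ h k ^ 2 :=
      pow_le_pow_left₀ (by positivity) (hbound k hk) 2
    have hscaled := mul_le_mul_of_nonneg_left hsq (mul_nonneg hlam0.le hgap)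
    have hU := sq_nonneg ‖h k • x k - (h k - 1) • x (k - 1) - xstar‖
    rw [le_div_iff₀ (by positivity)]
    linarith [henergy k hk]
  refine ⟨hrate, ?_⟩
  have hzero : Tendsto (fun k : ℕ => 2 * ‖x 0 - xstar‖ ^ 2 / (lam * ((k : ℝ) + 1) ^ 2)) atTop
      (𝓝 0) := by
    refine Tendsto.const_div_atTop (Tendsto.const_mul_atTop hlam0 ?_) _
    exact (tendsto_pow_atTop two_ne_zero).comp
      (tendsto_atTop_add_const_right _ 1 tendsto_natCast_atTop_atTop)
  refine tendsto_of_tendsto_of_tendsto_of_le_of_le' tendsto_const_nhds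
    (by simpa using hzero.const_add (PhiL1 A ψ p α xstar))
    (Eventually.of_forall fun k => hstar (x k)) ?_
  filter_upwards [eventually_ge_atTop 1] with k hk
  linarith [hrate k hk]
end
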